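/- Let p be an odd prime and r a positive integer. Then Z(p^r) ≡ -2 p^{r-1} B_{p-3} (mod p^r), as a congruence of rational numbers whose denominators are coprime to p. -/

import Mathlib

open Finset

/-- `x ≡ y (mod N)` for rationals: the denominator of `x - y` is coprime to `N`
and `N` divides the numerator of `x - y`. -/
def ratCong (N : ℕ) (x y : ℚ) : Prop :=
  Nat.Coprime (x - y).den N ∧ (N : ℤ) ∣ (x - y).num

/-- `Z n = ∑_{i+j+k=n, i,j,k coprime to n} 1/(ijk)` over ordered triples of
positive integers. -/
def Z (n : ℕ) : ℚ :=
  ∑ i ∈ Finset.Icc 1 n, ∑ j ∈ Finset.Icc 1 n, ∑ k ∈ Finset.Icc 1 n,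
    if i + j + k = n ∧ Nat.Coprime i n ∧ Nat.Coprime j n ∧ Nat.Coprime k n then
      1 / ((i : ℚ) * j * k)
    else 0

/-- The additive group of rationals of `p`-adic valuation at least `r`. -/
def padicBall (p : ℕ) [Fact p.Prime] (r : ℕ) : AddSubgroup ℚ where
  carrier := {x | padicNorm p x ≤ (p : ℚ) ^ (-(r : ℤ))}
  zero_mem' := by simp only [Set.mem_ofPred_eq, padicNorm.zero]; positivity
  add_mem' hx hy := padicNorm.nonarchimedean.trans (max_le hx hy)
  neg_mem' hx := by simpa using hx

section padicBall

variable {p : ℕ} [Fact p.Prime] {r s : ℕ} {x y : ℚ}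

theorem mem_padicBall : x ∈ padicBall p r ↔ padicNorm p x ≤ (p : ℚ) ^ (-(r : ℤ)) := Iff.rfl

theorem mul_mem_padicBall (hx : x ∈ padicBall p r) (hy : y ∈ padicBall p s) :
    x * y ∈ padicBall p (r + s) := by
  have hp : (p : ℚ) ≠ 0 := mod_cast (Fact.out : p.Prime).ne_zero
  rw [mem_padicBall] at *
  rw [padicNorm.mul, Nat.cast_add, neg_add, zpow_add₀ hp]
  exact mul_le_mul hx hy (padicNorm.nonneg _) (by positivity)

theorem mul_mem_padicBall_left (hx : x ∈ padicBall p r) (hy : y ∈ padicBall p 0) :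
    x * y ∈ padicBall p r := by
  simpa only [add_zero] using mul_mem_padicBall hx hy

theorem mul_mem_padicBall_right (hx : x ∈ padicBall p 0) (hy : y ∈ padicBall p r) :
    x * y ∈ padicBall p r := by
  simpa using mul_mem_padicBall hx hy

theorem padicBall_anti (h : r ≤ s) : padicBall p s ≤ padicBall p r := by
  intro x hx
  rw [mem_padicBall] at *
  have hp : (1 : ℚ) ≤ p := mod_cast (Fact.out : p.Prime).one_le
  exact hx.trans (zpow_le_zpow_right₀ hp (by omega))

theorem intCast_mem_padicBall_zero (z : ℤ) : (z : ℚ) ∈ padicBall p 0 := by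
  simpa [mem_padicBall] using padicNorm.of_int z

theorem natCast_mem_padicBall_zero (n : ℕ) : (n : ℚ) ∈ padicBall p 0 :=
  mod_cast intCast_mem_padicBall_zero (n : ℤ)

theorem intCast_mem_padicBall {z : ℤ} : (z : ℚ) ∈ padicBall p r ↔ (p : ℤ) ^ r ∣ z := by
  rw [mem_padicBall, ← padicNorm.dvd_iff_norm_le, Nat.cast_pow]

theorem natCast_pow_mem_padicBall : (p : ℚ) ^ r ∈ padicBall p r := by
  exact_mod_cast intCast_mem_padicBall (z := (p : ℤ) ^ r).2 dvd_rfl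

theorem natCast_mem_padicBall_one : (p : ℚ) ∈ padicBall p 1 := by
  simpa using natCast_pow_mem_padicBall (p := p) (r := 1)

theorem inv_natCast_mem_padicBall_zero {n : ℕ} (hn : ¬ p ∣ n) : (n : ℚ)⁻¹ ∈ padicBall p 0 := by
  rw [mem_padicBall, inv_eq_one_div, padicNorm.div, (padicNorm.nat_eq_one_iff n).2 hn]
  simp

theorem pow_mem_padicBall_zero (hx : x ∈ padicBall p 0) (n : ℕ) : x ^ n ∈ padicBall p 0 := by
  induction n with
  | zero => simpa using natCast_mem_padicBall_zero (p := p) 1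
  | succ n ih => exact pow_succ x n ▸ mul_mem_padicBall_left ih hx

theorem inv_mem_padicBall_zero_of_lt {n : ℕ} (h0 : n ≠ 0) (h : n < p) :
    (n : ℚ)⁻¹ ∈ padicBall p 0 :=
  inv_natCast_mem_padicBall_zero (Nat.not_dvd_of_pos_of_lt (Nat.pos_of_ne_zero h0) h)

theorem not_dvd_den_of_mem_padicBall (hx : x ∈ padicBall p r) : ¬ p ∣ x.den := by
  intro h
  have hx0 := padicBall_anti (Nat.zero_le r) hx
  have hnum : ((x.num : ℤ) : ℚ) ∈ padicBall p 1 := by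
    rw [← Rat.mul_den_eq_num x]
    refine mul_mem_padicBall_right hx0 ?_
    have := (intCast_mem_padicBall (p := p) (r := 1) (z := x.den)).2 (by simpa using mod_cast h)
    exact_mod_cast this
  rw [intCast_mem_padicBall, pow_one] at hnum
  have hp : p.Prime := Fact.out
  exact Nat.not_coprime_of_dvd_of_dvd hp.one_lt (Int.natCast_dvd.1 hnum) h x.reduced

theorem ratCong_of_sub_mem_padicBall (h : x - y ∈ padicBall p r) : ratCong (p ^ r) x y := by
  have hp : p.Prime := Fact.out
  refine ⟨?_, ?_⟩
  · exact (((Nat.Prime.coprime_iff_not_dvd hp).2 (not_dvd_den_of_mem_padicBall h)).pow_left r).symm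
  · push_cast
    rw [← intCast_mem_padicBall, ← Rat.mul_den_eq_num]
    exact mul_mem_padicBall_left h (natCast_mem_padicBall_zero _)

theorem mul_sub_mul_mem_padicBall {a b c d : ℚ} (ha : a ∈ padicBall p 0) (hd : d ∈ padicBall p 0)
    (hac : a - c ∈ padicBall p r) (hbd : b - d ∈ padicBall p r) :
    a * b - c * d ∈ padicBall p r := by
  have : a * b - c * d = a * (b - d) + (a - c) * d := by ring
  rw [this]
  exact add_mem (mul_mem_padicBall_right ha hbd) (mul_mem_padicBall_left hac hd)

theorem sum_sub_sum_mem_padicBall {ι : Type*} {S : Finset ι} {f g : ι → ℚ}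
    (h : ∀ i ∈ S, f i - g i ∈ padicBall p r) : ∑ i ∈ S, f i - ∑ i ∈ S, g i ∈ padicBall p r := by
  rw [← Finset.sum_sub_distrib]
  exact sum_mem h

theorem bernoulli_mem_padicBall_zero {k : ℕ} (hk : k + 1 < p) : bernoulli k ∈ padicBall p 0 := by
  induction k using Nat.strong_induction_on with
  | _ k ih =>
    have h := sum_bernoulli (k + 1)
    rw [Finset.sum_range_succ, Nat.choose_succ_self_right] at h
    have h1 : bernoulli k = ((k + 1 : ℕ) : ℚ)⁻¹ * ((if k + 1 = 1 then 1 else 0) -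
        ∑ j ∈ Finset.range k, ((k + 1).choose j : ℚ) * bernoulli j) := by
      rw [← h]
      have : ((k + 1 : ℕ) : ℚ) ≠ 0 := by positivity
      field_simp
      ring
    rw [h1]
    refine mul_mem_padicBall_right (inv_mem_padicBall_zero_of_lt k.succ_ne_zero hk)
      (sub_mem ?_ (sum_mem fun j hj => mul_mem_padicBall_right (natCast_mem_padicBall_zero _)
        (ih j (Finset.mem_range.1 hj) (by have := Finset.mem_range.1 hj; omega))))
    split_ifs
    · simpa using natCast_mem_padicBall_zero (p := p) 1
    · exact zero_mem _

end padicBall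

/-- The inverse of `i` if `i` is prime to `p`, and `0` otherwise. -/
def primeToInv (p i : ℕ) : ℚ := if p ∣ i then 0 else (i : ℚ)⁻¹

section primeToInv

variable {p : ℕ} {i : ℕ}

theorem primeToInv_of_dvd (h : p ∣ i) : primeToInv p i = 0 := if_pos h

theorem primeToInv_of_not_dvd (h : ¬ p ∣ i) : primeToInv p i = (i : ℚ)⁻¹ := if_neg h

variable [Fact p.Prime]

theorem primeToInv_mem_padicBall_zero : primeToInv p i ∈ padicBall p 0 := by
  rw [primeToInv]
  split_ifs with h
  · exact zero_mem _
  · exact inv_natCast_mem_padicBall_zero h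

theorem primeToInv_sub_add_primeToInv {r n : ℕ} (hr : 1 ≤ r) (hn : n = p ^ r) (hi : i ≤ n) :
    primeToInv p (n - i) + primeToInv p i ∈ padicBall p r := by
  have hpn : p ∣ n := hn ▸ dvd_pow_self p (by omega)
  by_cases h : p ∣ i
  · rw [primeToInv_of_dvd h, primeToInv_of_dvd (Nat.dvd_sub hpn h), add_zero]
    exact zero_mem _
  · have h' : ¬ p ∣ n - i := fun h' => h ((Nat.dvd_sub_iff_right hi hpn).1 h')
    have h0 : (i : ℚ) ≠ 0 := Nat.cast_ne_zero.2 (by rintro rfl; simp at h)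
    have h0' : ((n - i : ℕ) : ℚ) ≠ 0 := Nat.cast_ne_zero.2 (by intro e; simp [e] at h')
    rw [primeToInv_of_not_dvd h, primeToInv_of_not_dvd h']
    have : ((n - i : ℕ) : ℚ)⁻¹ + (i : ℚ)⁻¹ = (p : ℚ) ^ r * (((n - i : ℕ) : ℚ)⁻¹ * (i : ℚ)⁻¹) := by
      field_simp
      rw [Nat.cast_sub hi, hn]
      push_cast
      ring
    rw [this]
    exact mul_mem_padicBall_left natCast_pow_mem_padicBall (mul_mem_padicBall_left
      (inv_natCast_mem_padicBall_zero h') (inv_natCast_mem_padicBall_zero h))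

theorem primeToInv_add_mul {r : ℕ} (hr : 1 ≤ r) (y : ℕ) :
    primeToInv p (i + p ^ r * y) - (primeToInv p i - p ^ r * y * primeToInv p i ^ 2) ∈
      padicBall p (r + r) := by
  have hpn : p ∣ p ^ r * y := (dvd_pow_self p (by omega)).mul_right y
  by_cases h : p ∣ i
  · rw [primeToInv_of_dvd h, primeToInv_of_dvd (dvd_add h hpn)]
    simp [zero_mem]
  · have h' : ¬ p ∣ i + p ^ r * y := fun h' => h ((Nat.dvd_add_iff_left hpn).2 h')
    have h0 : (i : ℚ) ≠ 0 := Nat.cast_ne_zero.2 (by rintro rfl; simp at h)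
    have h0' : ((i + p ^ r * y : ℕ) : ℚ) ≠ 0 := Nat.cast_ne_zero.2 (by intro e; simp [e] at h')
    rw [primeToInv_of_not_dvd h, primeToInv_of_not_dvd h']
    have : ((i + p ^ r * y : ℕ) : ℚ)⁻¹ - ((i : ℚ)⁻¹ - p ^ r * y * (i : ℚ)⁻¹ ^ 2) =
        (p : ℚ) ^ r * p ^ r * ((y : ℚ) ^ 2 * ((i : ℚ)⁻¹ ^ 2 * ((i + p ^ r * y : ℕ) : ℚ)⁻¹)) := by
      field_simp
      push_cast
      ring
    rw [this]
    exact mul_mem_padicBall_left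
      (mul_mem_padicBall natCast_pow_mem_padicBall natCast_pow_mem_padicBall)
      (mul_mem_padicBall_left (pow_mem_padicBall_zero (natCast_mem_padicBall_zero _) _)
        (mul_mem_padicBall_left (pow_mem_padicBall_zero (inv_natCast_mem_padicBall_zero h) _)
          (inv_natCast_mem_padicBall_zero h')))

theorem primeToInv_sub_pow_mem_padicBall (hp2 : p ≠ 2) :
    primeToInv p i - (i : ℚ) ^ (p - 2) ∈ padicBall p 1 := by
  have hp : p.Prime := Fact.out
  have hp3 : 3 ≤ p := by have := hp.two_le; omega
  by_cases h : p ∣ i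
  · rw [primeToInv_of_dvd h, zero_sub]
    refine neg_mem ?_
    exact_mod_cast (intCast_mem_padicBall (p := p) (r := 1) (z := (i : ℤ) ^ (p - 2))).2
      (by simpa using dvd_pow (Int.natCast_dvd_natCast.2 h) (by omega : p - 2 ≠ 0))
  · have h0 : (i : ℚ) ≠ 0 := Nat.cast_ne_zero.2 (by rintro rfl; simp at h)
    rw [primeToInv_of_not_dvd h]
    have : (i : ℚ)⁻¹ - (i : ℚ) ^ (p - 2) = (i : ℚ)⁻¹ * ((1 - (i : ℤ) ^ (p - 1) : ℤ) : ℚ) := by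
      rw [show p - 1 = p - 2 + 1 by omega]
      push_cast
      field_simp
      ring
    rw [this]
    refine mul_mem_padicBall_right (inv_natCast_mem_padicBall_zero h)
      (intCast_mem_padicBall.2 ?_)
    rw [pow_one, ← ZMod.intCast_zmod_eq_zero_iff_dvd]
    push_cast
    rw [ZMod.pow_card_sub_one_eq_one ((ZMod.natCast_eq_zero_iff i p).not.2 h), sub_self]

theorem sum_range_pow_add_ite_mem_padicBall {e : ℕ} (he : e ≠ 0) :
    ∑ m ∈ Finset.range p, (m : ℚ) ^ e + (if p - 1 ∣ e then 1 else 0) ∈ padicBall p 1 := by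
  have hp : p.Prime := Fact.out
  have key : ∑ m ∈ Finset.range p, (m : ZMod p) ^ e + (if p - 1 ∣ e then 1 else 0) = 0 := by
    have h1 : ∑ m ∈ Finset.range p, (m : ZMod p) ^ e = ∑ x : ZMod p, x ^ e := by
      refine Finset.sum_bij' (fun m _ => (m : ZMod p)) (fun x _ => x.val) (by simp)
        (fun x _ => Finset.mem_range.2 (ZMod.val_lt x))
        (fun m hm => ZMod.val_cast_of_lt (Finset.mem_range.1 hm)) (by simp) (by simp)
    have h2 : ∑ x : (ZMod p)ˣ, (x : ZMod p) ^ e = ∑ x : ZMod p, x ^ e := by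
      refine Finset.sum_of_injOn (fun x : (ZMod p)ˣ => (x : ZMod p)) Units.val_injective.injOn
        (by simp) (fun x _ hx => ?_) (fun _ _ => rfl)
      by_cases h0 : x = 0
      · rw [h0, zero_pow he]
      · exact absurd ⟨Units.mk0 x h0, by simp, rfl⟩ hx
    rw [h1, ← h2, FiniteField.sum_pow_units, ZMod.card]
    split_ifs <;> simp
  have := (intCast_mem_padicBall (p := p) (r := 1)
    (z := ∑ m ∈ Finset.range p, (m : ℤ) ^ e + (if p - 1 ∣ e then 1 else 0))).2 (by
      rw [pow_one, ← ZMod.intCast_zmod_eq_zero_iff_dvd, ← key]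
      push_cast
      rfl)
  push_cast at this
  exact this

end primeToInv

section Reindexing

variable {M : Type*} [AddCommMonoid M]

theorem sum_range_mul_eq_sum_sum (m n : ℕ) (f : ℕ → M) :
    ∑ i ∈ range (m * n), f i = ∑ x ∈ range n, ∑ y ∈ range m, f (x + n * y) := by
  induction m with
  | zero => simp
  | succ m ih =>
    rw [add_one_mul, sum_range_add, ih, ← sum_add_distrib]
    refine sum_congr rfl fun x _ => ?_
    rw [sum_range_succ, add_comm x (n * m), mul_comm n m]

theorem sum_range_eq_sum_range_sub {n : ℕ} {f : ℕ → M} (h0 : f 0 = 0) (hn : f n = 0) :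
    ∑ i ∈ range n, f i = ∑ i ∈ range n, f (n - i) := by
  have h1 := sum_range_reflect f (n + 1)
  rw [sum_range_succ, sum_range_succ] at h1
  simpa [h0, hn] using h1.symm

theorem sum_Icc_one_eq_sum_range {n : ℕ} {f : ℕ → M} (h0 : f 0 = 0) (hn : f n = 0) :
    ∑ i ∈ Icc 1 n, f i = ∑ i ∈ range n, f i := by
  have h1 : ∑ i ∈ range (n + 1), f i = ∑ i ∈ Icc 1 n, f i := by
    rw [sum_range_succ', h0, add_zero, range_eq_Ico, sum_Ico_add' f 0 n 1]
    rfl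
  rw [← h1, sum_range_succ, hn, add_zero]

theorem sum_range_ite_add_eq {n s a : ℕ} (hs : s < n) (f : ℕ → M) :
    ∑ k ∈ range n, (if a + k = s then f k else 0) = if a ≤ s then f (s - a) else 0 := by
  split_ifs with h
  · rw [sum_eq_single_of_mem (s - a) (by simp; omega) fun k _ hk => if_neg (by omega),
      if_pos (by omega)]
  · exact sum_eq_zero fun k _ => if_neg (by omega)

theorem sum_range_ite_add_le {n s a : ℕ} (hs : s < n) (f : ℕ → M) :
    ∑ k ∈ range n, (if a + k ≤ s then f k else 0) =
      if a ≤ s then ∑ k ∈ range (s - a + 1), f k else 0 := by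
  rw [← sum_filter]
  split_ifs with h
  · congr 1
    ext k
    simp only [mem_filter, mem_range]
    omega
  · rw [filter_false_of_mem (by intro k _; omega), sum_empty]

end Reindexing

theorem sum_sum_sum_ite_add_eq_linear {n d : ℕ} (hd : d < n) (A B C D : ℚ) :
    ∑ x ∈ range n, ∑ y ∈ range n, ∑ z ∈ range n,
      (if x + y + z = d then A + B * x + C * y + D * z else 0) =
    A * ((d + 1) * (d + 2) / 2) + (B + C + D) * (d * (d + 1) * (d + 2) / 6) := by
  have inner (m : ℕ) (a b : ℚ) : ∑ y ∈ range m, (a + b * y) = a * m + b * (m * (m - 1) / 2) := by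
    induction m with
    | zero => simp
    | succ m ih =>
      rw [sum_range_succ, ih]
      push_cast
      ring
  have outer (m : ℕ) : ∑ x ∈ range m, ((A + B * (d - x) + D * x) * ((x + 1 : ℕ) : ℚ) +
      (C - D) * (((x + 1 : ℕ) : ℚ) * ((x + 1 : ℕ) - 1) / 2)) =
      (A + B * d) * (m * (m + 1) / 2) + (C + D - 2 * B) * ((m - 1) * m * (m + 1) / 6) := by
    induction m with
    | zero => simp
    | succ m ih =>
      rw [sum_range_succ, ih]
      push_cast
      ring
  have h1 : ∀ x ∈ range n, ∑ y ∈ range n, ∑ z ∈ range n,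
      (if x + y + z = d then A + B * x + C * y + D * z else 0) =
      if 0 + x ≤ d then ∑ y ∈ range (d - x + 1),
        (A + B * x + C * y + D * ((d - (x + y) : ℕ) : ℚ)) else 0 := by
    intro x _
    simp_rw [sum_range_ite_add_eq hd fun z : ℕ => A + B * x + C * _ + D * (z : ℚ)]
    rw [sum_range_ite_add_le hd, zero_add]
  rw [sum_congr rfl h1, sum_range_ite_add_le hd, if_pos (Nat.zero_le d), Nat.sub_zero,
    ← sum_range_reflect]
  have h2 : ∀ x ∈ range (d + 1), ∑ y ∈ range (d - (d + 1 - 1 - x) + 1),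
      (A + B * ((d + 1 - 1 - x : ℕ) : ℚ) + C * y + D * ((d - (d + 1 - 1 - x + y) : ℕ) : ℚ)) =
      (A + B * (d - x) + D * x) * ((x + 1 : ℕ) : ℚ) +
        (C - D) * (((x + 1 : ℕ) : ℚ) * ((x + 1 : ℕ) - 1) / 2) := by
    intro x hx
    have hx' := mem_range.1 hx
    rw [← inner, show d - (d + 1 - 1 - x) = x by omega]
    refine sum_congr rfl fun y hy => ?_
    have hy' := mem_range.1 hy
    rw [show d + 1 - 1 - x = d - x by omega, show d - (d - x + y) = x - y by omega,
      Nat.cast_sub (by omega), Nat.cast_sub (by omega)]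
    ring
  rw [sum_congr rfl h2, outer]
  push_cast
  ring

/-- The sum of `1 / (i * j * k)` over the triples `i, j, k < n` prime to `p` with sum `s`. -/
def primeToTripleSum (p n s : ℕ) : ℚ :=
  ∑ i ∈ range n, ∑ j ∈ range n, ∑ k ∈ range n,
    if i + j + k = s then primeToInv p i * primeToInv p j * primeToInv p k else 0

section primeToTripleSum

variable {p r : ℕ}

theorem Z_eq_primeToTripleSum (hp : p.Prime) (hr : 1 ≤ r) :
    Z (p ^ r) = primeToTripleSum p (p ^ r) (p ^ r) := by
  have h0 : primeToInv p 0 = 0 := primeToInv_of_dvd (dvd_zero p)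
  have hn : primeToInv p (p ^ r) = 0 := primeToInv_of_dvd (dvd_pow_self p (by omega))
  have hcop (i : ℕ) : Nat.Coprime i (p ^ r) ↔ ¬ p ∣ i := by
    rw [Nat.coprime_pow_right_iff hr, Nat.coprime_comm, hp.coprime_iff_not_dvd]
  have hterm (i j k : ℕ) : (if i + j + k = p ^ r ∧ Nat.Coprime i (p ^ r) ∧
      Nat.Coprime j (p ^ r) ∧ Nat.Coprime k (p ^ r) then 1 / ((i : ℚ) * j * k) else 0) =
      if i + j + k = p ^ r then primeToInv p i * primeToInv p j * primeToInv p k else 0 := by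
    simp only [hcop, primeToInv]
    by_cases hi : p ∣ i <;> by_cases hj : p ∣ j <;> by_cases hk : p ∣ k <;>
      simp [hi, hj, hk, mul_comm]
  simp only [Z, primeToTripleSum, hterm]
  rw [sum_Icc_one_eq_sum_range (by simp [h0]) (by simp [hn])]
  refine sum_congr rfl fun i _ => ?_
  rw [sum_Icc_one_eq_sum_range (by simp [h0]) (by simp [hn])]
  refine sum_congr rfl fun j _ => ?_
  rw [sum_Icc_one_eq_sum_range (by simp [h0]) (by simp [hn])]

variable [Fact p.Prime]

theorem primeToTripleSum_two_mul_add_mem (hr : 1 ≤ r) :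
    primeToTripleSum p (p ^ r) (2 * p ^ r) + primeToTripleSum p (p ^ r) (p ^ r) ∈
      padicBall p r := by
  have h0 : primeToInv p 0 = 0 := primeToInv_of_dvd (dvd_zero p)
  have hn : primeToInv p (p ^ r) = 0 := primeToInv_of_dvd (dvd_pow_self p (by omega))
  have hrefl : primeToTripleSum p (p ^ r) (2 * p ^ r) =
      ∑ i ∈ range (p ^ r), ∑ j ∈ range (p ^ r), ∑ k ∈ range (p ^ r),
        if i + j + k = p ^ r then primeToInv p (p ^ r - i) * primeToInv p (p ^ r - j) *
          primeToInv p (p ^ r - k) else 0 := by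
    rw [primeToTripleSum, sum_range_eq_sum_range_sub (by simp [h0]) (by simp [hn])]
    refine sum_congr rfl fun i hi => ?_
    rw [sum_range_eq_sum_range_sub (by simp [h0]) (by simp [hn])]
    refine sum_congr rfl fun j hj => ?_
    rw [sum_range_eq_sum_range_sub (by simp [h0]) (by simp [hn])]
    refine sum_congr rfl fun k hk => if_congr ?_ rfl rfl
    rw [mem_range] at hi hj hk
    omega
  rw [hrefl, primeToTripleSum, ← sum_add_distrib]
  refine sum_mem fun i hi => ?_
  rw [← sum_add_distrib]
  refine sum_mem fun j hj => ?_
  rw [← sum_add_distrib]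
  refine sum_mem fun k hk => ?_
  rw [mem_range] at hi hj hk
  split_ifs
  · have e (a b c a' b' c' : ℚ) : a' * b' * c' + a * b * c = a' * b' * c' - -a * -b * -c := by ring
    have u (x : ℕ) : primeToInv p x ∈ padicBall p 0 := primeToInv_mem_padicBall_zero
    have v {x : ℕ} (hx : x < p ^ r) :
        primeToInv p (p ^ r - x) - -primeToInv p x ∈ padicBall p r := by
      rw [sub_neg_eq_add]
      exact primeToInv_sub_add_primeToInv hr rfl hx.le
    rw [e]
    exact mul_sub_mul_mem_padicBall (mul_mem_padicBall_left (u _) (u _)) (neg_mem (u _))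
      (mul_sub_mul_mem_padicBall (u _) (neg_mem (u _)) (v hi) (v hj)) (v hk)
  · simp [zero_mem]

/-- The tetrahedral numbers `(p - s)(p - s + 1)(p - s + 2) / 6` for `s = 1, 2` are divisible by `p`
when `p > 3`; for `p = 3` the sum of the inverses is. -/
theorem tetrahedral_mul_sum_inv_mem (hp2 : p ≠ 2) {x y z s d : ℕ} (hx : ¬ p ∣ x) (hy : ¬ p ∣ y)
    (hz : ¬ p ∣ z) (hsum : p ∣ x + y + z) (hs : s = 1 ∨ s = 2) (hd : d + s = p) :
    (d * (d + 1) * (d + 2) / 6 : ℚ) *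
      (primeToInv p x + primeToInv p y + primeToInv p z) ∈ padicBall p 1 := by
  have hp : p.Prime := Fact.out
  have u (x : ℕ) : primeToInv p x ∈ padicBall p 0 := primeToInv_mem_padicBall_zero
  have hp3 : 3 ≤ p := by have := hp.two_le; omega
  rcases hp3.eq_or_lt with h3 | h3
  · have h6 : (d * (d + 1) * (d + 2) / 6 : ℚ) ∈ padicBall p 0 := by
      rcases hs with rfl | rfl
      · obtain rfl : d = 2 := by omega
        convert natCast_mem_padicBall_zero (p := p) 4 using 1
        norm_num
      · obtain rfl : d = 1 := by omega
        convert natCast_mem_padicBall_zero (p := p) 1 using 1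
        norm_num
    refine mul_mem_padicBall_right h6 ?_
    have ne {x : ℕ} (hx : ¬ p ∣ x) : (x : ℚ) ≠ 0 := Nat.cast_ne_zero.2 (by rintro rfl; simp at hx)
    have hx0 := ne hx
    have hy0 := ne hy
    have hz0 := ne hz
    have e : primeToInv p x + primeToInv p y + primeToInv p z =
        ((x * y + y * z + z * x : ℤ) : ℚ) * (primeToInv p x * primeToInv p y * primeToInv p z) := by
      rw [primeToInv_of_not_dvd hx, primeToInv_of_not_dvd hy, primeToInv_of_not_dvd hz]
      push_cast
      field_simp
      ring
    rw [e]
    refine mul_mem_padicBall_left (intCast_mem_padicBall.2 ?_)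
      (mul_mem_padicBall_left (mul_mem_padicBall_left (u _) (u _)) (u _))
    rw [pow_one]
    rw [← ZMod.natCast_eq_zero_iff] at hx hy hz hsum
    rw [← ZMod.intCast_zmod_eq_zero_iff_dvd]
    push_cast at hsum ⊢
    generalize (x : ZMod p) = x, (y : ZMod p) = y, (z : ZMod p) = z at *
    have key : ∀ x y z : ZMod 3, x ≠ 0 → y ≠ 0 → z ≠ 0 → x + y + z = 0 →
        x * y + y * z + z * x = 0 := by decide
    subst h3
    exact key x y z hx hy hz hsum
  · have inv2 : (2 : ℚ)⁻¹ ∈ padicBall p 0 :=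
      inv_mem_padicBall_zero_of_lt (n := 2) two_ne_zero (by omega)
    have inv3 : (3 : ℚ)⁻¹ ∈ padicBall p 0 :=
      inv_mem_padicBall_zero_of_lt (n := 3) three_ne_zero h3
    have hdp : (d : ℚ) = p - s := by rw [← hd]; push_cast; ring
    have hint : ∃ z : ℤ, (d * (d + 1) * (d + 2) / 6 : ℚ) = p * z * (2⁻¹ * 3⁻¹) := by
      rcases hs with rfl | rfl
      · exact ⟨(p - 1) * (p + 1), by rw [hdp]; push_cast; ring⟩
      · exact ⟨(p - 2) * (p - 1), by rw [hdp]; push_cast; ring⟩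
    obtain ⟨z, hz⟩ := hint
    rw [hz]
    exact mul_mem_padicBall_left (mul_mem_padicBall_left (mul_mem_padicBall_left
      natCast_mem_padicBall_one (intCast_mem_padicBall_zero z)) (mul_mem_padicBall_left inv2 inv3))
      (add_mem (add_mem (u _) (u _)) (u _))

theorem sum_digits_primeToInv_mem (hp2 : p ≠ 2) (hr : 1 ≤ r) {x y z s d : ℕ}
    (hs : s = 1 ∨ s = 2) (hd : d + s = p) (hsum : x + y + z = s * p ^ r) :
    ∑ a ∈ range p, ∑ b ∈ range p, ∑ c ∈ range p,
      (if x + p ^ r * a + (y + p ^ r * b) + (z + p ^ r * c) = p * p ^ r then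
        primeToInv p (x + p ^ r * a) * primeToInv p (y + p ^ r * b) *
          primeToInv p (z + p ^ r * c) else 0) -
      primeToInv p x * primeToInv p y * primeToInv p z * ((d + 1) * (d + 2) / 2) ∈
      padicBall p (r + 1) := by
  have hp : p.Prime := Fact.out
  have hq : 0 < p ^ r := pow_pos hp.pos r
  have hpq : p ∣ p ^ r := dvd_pow_self p (by omega)
  have u (x : ℕ) : primeToInv p x ∈ padicBall p 0 := primeToInv_mem_padicBall_zero
  set U := primeToInv p x * primeToInv p y * primeToInv p z with hU
  have hUmem : U ∈ padicBall p 0 :=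
    mul_mem_padicBall_left (mul_mem_padicBall_left (u x) (u y)) (u z)
  have hcond (a b c : ℕ) :
      x + p ^ r * a + (y + p ^ r * b) + (z + p ^ r * c) = p * p ^ r ↔ a + b + c = d := by
    have e : x + p ^ r * a + (y + p ^ r * b) + (z + p ^ r * c) = p ^ r * (a + b + c + s) := by
      linear_combination hsum
    rw [e, mul_comm p, Nat.mul_right_inj hq.ne']
    omega
  have hmain : (d * (d + 1) * (d + 2) / 6 : ℚ) * U *
      (primeToInv p x + primeToInv p y + primeToInv p z) ∈ padicBall p 1 := by
    by_cases h : p ∣ x ∨ p ∣ y ∨ p ∣ z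
    · have : U = 0 := by
        rcases h with h | h | h <;> simp [hU, primeToInv_of_dvd h]
      simp [this, zero_mem]
    · push Not at h
      rw [mul_right_comm]
      exact mul_mem_padicBall_left (tetrahedral_mul_sum_inv_mem hp2 h.1 h.2.1 h.2.2
        (hsum ▸ hpq.mul_left s) hs hd) hUmem
  have hlin := sum_sum_sum_ite_add_eq_linear (n := p) (d := d) (by omega) U
    (-(p ^ r * (U * primeToInv p x))) (-(p ^ r * (U * primeToInv p y)))
    (-(p ^ r * (U * primeToInv p z)))
  have hsub : U * ((d + 1) * (d + 2) / 2) = ∑ a ∈ range p, ∑ b ∈ range p, ∑ c ∈ range p,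
      (if a + b + c = d then U + -(p ^ r * (U * primeToInv p x)) * a +
        -(p ^ r * (U * primeToInv p y)) * b + -(p ^ r * (U * primeToInv p z)) * c else 0) +
      p ^ r * ((d * (d + 1) * (d + 2) / 6 : ℚ) * U *
        (primeToInv p x + primeToInv p y + primeToInv p z)) := by
    rw [hlin]
    ring
  rw [hsub, ← sub_sub]
  refine sub_mem ?_ (mul_mem_padicBall natCast_pow_mem_padicBall hmain)
  refine sum_sub_sum_mem_padicBall fun a _ => sum_sub_sum_mem_padicBall fun b _ =>
    sum_sub_sum_mem_padicBall fun c _ => ?_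
  simp only [hcond]
  split_ifs
  · have v (x a : ℕ) : primeToInv p (x + p ^ r * a) -
        (primeToInv p x - p ^ r * a * primeToInv p x ^ 2) ∈ padicBall p (r + 1) :=
      padicBall_anti (by omega) (primeToInv_add_mul hr a)
    have w (x a : ℕ) : primeToInv p x - p ^ r * a * primeToInv p x ^ 2 ∈ padicBall p 0 :=
      sub_mem (u x) (mul_mem_padicBall_left (mul_mem_padicBall_left
        (padicBall_anti (Nat.zero_le r) natCast_pow_mem_padicBall)
        (natCast_mem_padicBall_zero a)) (pow_mem_padicBall_zero (u x) 2))
    have h1 := mul_sub_mul_mem_padicBall (mul_mem_padicBall_left (u _) (u _)) (w z c)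
      (mul_sub_mul_mem_padicBall (u _) (w y b) (v x a) (v y b)) (v z c)
    have h2 : (p : ℚ) ^ r * p ^ r * (U * (primeToInv p x * primeToInv p y * a * b +
        primeToInv p x * primeToInv p z * a * c + primeToInv p y * primeToInv p z * b * c -
        p ^ r * (U * (a * b * c)))) ∈ padicBall p (r + 1) := by
      have n (a : ℕ) : (a : ℚ) ∈ padicBall p 0 := natCast_mem_padicBall_zero a
      have m {a b : ℚ} (ha : a ∈ padicBall p 0) (hb : b ∈ padicBall p 0) :
        a * b ∈ padicBall p 0 := mul_mem_padicBall_left ha hb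
      refine padicBall_anti (by omega : r + 1 ≤ r + r) (mul_mem_padicBall_left
        (mul_mem_padicBall natCast_pow_mem_padicBall natCast_pow_mem_padicBall)
        (m hUmem (sub_mem (add_mem (add_mem ?_ ?_) ?_) ?_)))
      · exact m (m (m (u x) (u y)) (n a)) (n b)
      · exact m (m (m (u x) (u z)) (n a)) (n c)
      · exact m (m (m (u y) (u z)) (n b)) (n c)
      · exact m (padicBall_anti (Nat.zero_le r) natCast_pow_mem_padicBall)
          (m hUmem (m (m (n a) (n b)) (n c)))
    convert add_mem h1 h2 using 1
    rw [hU]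
    ring
  · simp [zero_mem]

theorem primeToTripleSum_pow_succ_sub_mem (hp2 : p ≠ 2) (hr : 1 ≤ r) :
    primeToTripleSum p (p ^ (r + 1)) (p ^ (r + 1)) - p * primeToTripleSum p (p ^ r) (p ^ r) ∈
      padicBall p (r + 1) := by
  have hp : p.Prime := Fact.out
  have hp3 : 3 ≤ p := by have := hp.two_le; omega
  have hpq : p ∣ p ^ r := dvd_pow_self p (by omega)
  have hexp : primeToTripleSum p (p ^ (r + 1)) (p ^ (r + 1)) =
      ∑ x ∈ range (p ^ r), ∑ y ∈ range (p ^ r), ∑ z ∈ range (p ^ r),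
      ∑ a ∈ range p, ∑ b ∈ range p, ∑ c ∈ range p,
      (if x + p ^ r * a + (y + p ^ r * b) + (z + p ^ r * c) = p * p ^ r then
        primeToInv p (x + p ^ r * a) * primeToInv p (y + p ^ r * b) *
          primeToInv p (z + p ^ r * c) else 0) := by
    rw [primeToTripleSum, pow_succ']
    simp only [sum_range_mul_eq_sum_sum p (p ^ r)]
    refine sum_congr rfl fun x _ => ?_
    rw [sum_comm]
    refine sum_congr rfl fun y _ => ?_
    rw [sum_congr rfl fun a _ => sum_comm, sum_comm]
  have hdigit : primeToTripleSum p (p ^ (r + 1)) (p ^ (r + 1)) -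
      (primeToTripleSum p (p ^ r) (p ^ r) * (p * (p + 1) / 2) +
        primeToTripleSum p (p ^ r) (2 * p ^ r) * (p * (p - 1) / 2)) ∈ padicBall p (r + 1) := by
    rw [hexp]
    simp only [primeToTripleSum, sum_mul, ← sum_add_distrib]
    refine sum_sub_sum_mem_padicBall fun x hx => sum_sub_sum_mem_padicBall fun y hy =>
      sum_sub_sum_mem_padicBall fun z hz => ?_
    rw [mem_range] at hx hy hz
    by_cases h1 : x + y + z = p ^ r
    · have := sum_digits_primeToInv_mem hp2 hr (s := 1) (d := p - 1) (Or.inl rfl) (by omega)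
        (by simpa using h1)
      rw [Nat.cast_sub (by omega)] at this
      rw [if_pos h1, if_neg (by omega)]
      convert this using 2
      push_cast
      ring
    by_cases h2 : x + y + z = 2 * p ^ r
    · have := sum_digits_primeToInv_mem hp2 hr (s := 2) (d := p - 2) (Or.inr rfl) (by omega) h2
      rw [Nat.cast_sub (by omega)] at this
      rw [if_neg h1, if_pos h2]
      convert this using 2
      push_cast
      ring
    rw [if_neg h1, if_neg h2, zero_mul, zero_mul, add_zero, sub_zero]
    refine sum_mem fun a _ => sum_mem fun b _ => sum_mem fun c _ => ?_
    split_ifs with h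
    · have hdvd : p ^ r ∣ x + y + z := by
        rw [Nat.dvd_add_iff_left (Dvd.intro (a + b + c) rfl)]
        exact ⟨p, by linear_combination h⟩
      obtain ⟨m, hm⟩ := hdvd
      have hm3 : m < 3 := lt_of_mul_lt_mul_left (a := p ^ r) (by omega) (Nat.zero_le _)
      interval_cases m
      · have : x = 0 := by omega
        subst this
        rw [primeToInv_of_dvd (by simpa using hpq.mul_right a)]
        simp [zero_mem]
      · omega
      · omega
    · exact zero_mem _
  have hrefl : primeToTripleSum p (p ^ r) (2 * p ^ r) + primeToTripleSum p (p ^ r) (p ^ r) ∈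
      padicBall p r := primeToTripleSum_two_mul_add_mem hr
  have inv2 : (2 : ℚ)⁻¹ ∈ padicBall p 0 :=
    inv_mem_padicBall_zero_of_lt (n := 2) two_ne_zero (by omega)
  have h3 := mul_mem_padicBall hrefl (mul_mem_padicBall_left (natCast_mem_padicBall_one (p := p))
    (mul_mem_padicBall_left (intCast_mem_padicBall_zero ((p : ℤ) - 1)) inv2))
  convert add_mem hdigit h3 using 1
  push_cast
  ring

theorem primeToTripleSum_self_sub_mem :
    primeToTripleSum p p p - -2 * ∑ m ∈ range p, primeToInv p m ^ 2 *
      ∑ i ∈ range m, primeToInv p i ∈ padicBall p 1 := by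
  have hp : p.Prime := Fact.out
  have h0 : primeToInv p 0 = 0 := primeToInv_of_dvd (dvd_zero p)
  have u (x : ℕ) : primeToInv p x ∈ padicBall p 0 := primeToInv_mem_padicBall_zero
  have hT : primeToTripleSum p p p = ∑ m ∈ range p, ∑ i ∈ range (m + 1),
      primeToInv p i * primeToInv p (m - i) * primeToInv p (p - m) := by
    have hrefl (i j : ℕ) : ∑ k ∈ range p, (if i + j + k = p then
        primeToInv p i * primeToInv p j * primeToInv p k else 0) =
        ∑ m ∈ range p, if i + j = m then
          primeToInv p i * primeToInv p j * primeToInv p (p - m) else 0 := by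
      rw [sum_range_eq_sum_range_sub (by simp [h0])
        (by simp [primeToInv_of_dvd (dvd_refl p)])]
      refine sum_congr rfl fun m hm => if_congr ?_ rfl rfl
      rw [mem_range] at hm
      omega
    simp only [primeToTripleSum, hrefl]
    rw [sum_congr rfl fun i _ => sum_comm, sum_comm]
    refine sum_congr rfl fun m hm => ?_
    have hm' := mem_range.1 hm
    rw [sum_congr rfl fun i _ => sum_range_ite_add_eq hm'
      fun j => primeToInv p i * primeToInv p j * primeToInv p (p - m)]
    simpa using sum_range_ite_add_le (a := 0) hm'
      fun i => primeToInv p i * primeToInv p (m - i) * primeToInv p (p - m)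
  rw [hT, mul_sum]
  refine sum_sub_sum_mem_padicBall fun m hm => ?_
  have hm' := mem_range.1 hm
  have hconv : ∑ i ∈ range (m + 1), primeToInv p i * primeToInv p (m - i) * primeToInv p m =
      2 * (primeToInv p m ^ 2 * ∑ i ∈ range m, primeToInv p i) := by
    rw [sum_range_succ, Nat.sub_self, h0, mul_zero, zero_mul, add_zero]
    have hsum : ∑ i ∈ range m, primeToInv p (m - i) = ∑ i ∈ range m, primeToInv p i +
        primeToInv p m := by
      rw [← sum_range_succ, ← sum_range_reflect _ (m + 1), sum_range_succ]
      simp [h0]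
    have hterm : ∀ i ∈ range m, primeToInv p i * primeToInv p (m - i) * primeToInv p m =
        primeToInv p m ^ 2 * (primeToInv p i + primeToInv p (m - i)) -
          if i = 0 then primeToInv p m ^ 3 else 0 := by
      intro i hi
      have hi' := mem_range.1 hi
      split_ifs with hi0
      · subst hi0
        rw [h0, Nat.sub_zero]
        ring
      · rw [primeToInv_of_not_dvd (Nat.not_dvd_of_pos_of_lt (by omega : 0 < m) hm'),
          primeToInv_of_not_dvd (Nat.not_dvd_of_pos_of_lt (by omega : 0 < i) (by omega)),
          primeToInv_of_not_dvd (Nat.not_dvd_of_pos_of_lt (by omega : 0 < m - i) (by omega)),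
          Nat.cast_sub hi'.le]
        have e1 : (i : ℚ) ≠ 0 := by exact_mod_cast hi0
        have e2 : (m : ℚ) ≠ 0 := Nat.cast_ne_zero.2 (by omega)
        have e3 : (m : ℚ) - i ≠ 0 := sub_ne_zero.2 (by exact_mod_cast hi'.ne')
        field_simp
        ring
    rw [sum_congr rfl hterm, sum_sub_distrib, ← mul_sum, sum_add_distrib, hsum, sum_ite_eq']
    split_ifs with hm0
    · ring
    · obtain rfl : m = 0 := by simpa using hm0
      simp [h0]
  rw [neg_mul, ← hconv, sub_neg_eq_add, ← sum_add_distrib]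
  refine sum_mem fun i _ => ?_
  rw [← mul_add]
  refine mul_mem_padicBall_right (mul_mem_padicBall_left (u _) (u _)) ?_
  exact primeToInv_sub_add_primeToInv le_rfl (pow_one p).symm hm'.le

theorem sum_primeToInv_sq_mul_sum_sub_bernoulli_mem (hp2 : p ≠ 2) :
    ∑ m ∈ range p, primeToInv p m ^ 2 * ∑ i ∈ range m, primeToInv p i - bernoulli (p - 3) ∈
      padicBall p 1 := by
  have hp : p.Prime := Fact.out
  have u (x : ℕ) : primeToInv p x ∈ padicBall p 0 := primeToInv_mem_padicBall_zero
  have n (a : ℕ) : (a : ℚ) ∈ padicBall p 0 := natCast_mem_padicBall_zero a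
  obtain ⟨t, rfl⟩ : ∃ t, p = t + 3 := ⟨p - 3, by have := hp.two_le; omega⟩
  have v (i : ℕ) : primeToInv (t + 3) i - (i : ℚ) ^ (t + 1) ∈ padicBall (t + 3) 1 :=
    primeToInv_sub_pow_mem_padicBall hp2
  have hpow : ∑ m ∈ range (t + 3), primeToInv (t + 3) m ^ 2 * ∑ i ∈ range m, primeToInv (t + 3) i -
      ∑ m ∈ range (t + 3), (m : ℚ) ^ (2 * (t + 1)) * ∑ i ∈ range m, (i : ℚ) ^ (t + 1) ∈
        padicBall (t + 3) 1 := by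
    refine sum_sub_sum_mem_padicBall fun m _ => mul_sub_mul_mem_padicBall
      (pow_mem_padicBall_zero (u m) 2) (sum_mem fun i _ => pow_mem_padicBall_zero (n i) _) ?_
      (sum_sub_sum_mem_padicBall fun i _ => v i)
    rw [mul_comm, pow_mul, pow_two, pow_two]
    exact mul_sub_mul_mem_padicBall (u m) (pow_mem_padicBall_zero (n m) _) (v m) (v m)
  have hfaul : ∑ m ∈ range (t + 3), (m : ℚ) ^ (2 * (t + 1)) * ∑ i ∈ range m, (i : ℚ) ^ (t + 1) =
      ∑ k ∈ range (t + 2), bernoulli k * ((t + 2).choose k : ℚ) * ((t + 2 : ℕ) : ℚ)⁻¹ *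
        ∑ m ∈ range (t + 3), (m : ℚ) ^ (2 * (t + 1) + (t + 2 - k)) := by
    simp only [sum_range_pow _ (t + 1), mul_sum]
    rw [sum_comm]
    refine sum_congr rfl fun k _ => sum_congr rfl fun m _ => ?_
    rw [pow_add]
    push_cast
    ring
  have inv : ((t + 2 : ℕ) : ℚ)⁻¹ ∈ padicBall (t + 3) 0 :=
    inv_mem_padicBall_zero_of_lt (by omega) (by omega)
  have hcoeff {k : ℕ} (hk : k ∈ range (t + 2)) :
      bernoulli k * ((t + 2).choose k : ℚ) * ((t + 2 : ℕ) : ℚ)⁻¹ ∈ padicBall (t + 3) 0 :=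
    mul_mem_padicBall_left (mul_mem_padicBall_left
      (bernoulli_mem_padicBall_zero (by have := mem_range.1 hk; omega)) (n _)) inv
  have hdvd {k : ℕ} (hk : k ∈ range (t + 2)) : t + 3 - 1 ∣ 2 * (t + 1) + (t + 2 - k) ↔ k = t := by
    have hk' := mem_range.1 hk
    constructor
    · rintro ⟨c, hc⟩
      simp only [show t + 3 - 1 = t + 2 from rfl] at hc
      have h1 : 1 < c := by
        by_contra! h
        have := Nat.mul_le_mul_left (t + 2) h
        omega
      have h2 : c < 3 := by
        by_contra! h
        have := Nat.mul_le_mul_left (t + 2) h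
        omega
      obtain rfl : c = 2 := by omega
      omega
    · rintro rfl
      exact ⟨2, by omega⟩
  have hsums : ∑ k ∈ range (t + 2), bernoulli k * ((t + 2).choose k : ℚ) * ((t + 2 : ℕ) : ℚ)⁻¹ *
        ∑ m ∈ range (t + 3), (m : ℚ) ^ (2 * (t + 1) + (t + 2 - k)) -
      ∑ k ∈ range (t + 2), bernoulli k * ((t + 2).choose k : ℚ) * ((t + 2 : ℕ) : ℚ)⁻¹ *
        -(if k = t then 1 else 0) ∈ padicBall (t + 3) 1 := by
    refine sum_sub_sum_mem_padicBall fun k hk => ?_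
    rw [← mul_sub, sub_neg_eq_add]
    have := sum_range_pow_add_ite_mem_padicBall (p := t + 3)
      (e := 2 * (t + 1) + (t + 2 - k)) (by omega)
    simp only [hdvd hk] at this
    exact mul_mem_padicBall_right (hcoeff hk) this
  have hlast : ∑ k ∈ range (t + 2), bernoulli k * ((t + 2).choose k : ℚ) * ((t + 2 : ℕ) : ℚ)⁻¹ *
        -(if k = t then 1 else 0) - bernoulli t ∈ padicBall (t + 3) 1 := by
    simp only [mul_neg, mul_ite, mul_one, mul_zero, sum_neg_distrib, sum_ite_eq']
    rw [if_pos (by simp)]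
    have inv2 : (2 : ℚ)⁻¹ ∈ padicBall (t + 3) 0 :=
      inv_mem_padicBall_zero_of_lt (n := 2) two_ne_zero (by omega)
    have hch : ((t + 2).choose t : ℚ) = (t + 2) * (t + 1) / 2 := by
      rw [Nat.choose_symm_add, Nat.cast_choose_two]
      push_cast
      ring
    have hB : bernoulli t ∈ padicBall (t + 3) 0 := bernoulli_mem_padicBall_zero (by omega)
    convert mul_mem_padicBall_left (natCast_mem_padicBall_one (p := t + 3))
      (neg_mem (mul_mem_padicBall_left hB inv2)) using 1
    rw [hch]
    have : (t : ℚ) + 2 ≠ 0 := by positivity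
    push_cast
    field_simp
    ring
  rw [hfaul] at hpow
  simpa only [sub_add_sub_cancel, Nat.add_sub_cancel] using add_mem (add_mem hpow hsums) hlast

theorem primeToTripleSum_pow_sub_bernoulli_mem (hp2 : p ≠ 2) (hr : 1 ≤ r) :
    primeToTripleSum p (p ^ r) (p ^ r) - -2 * (p : ℚ) ^ (r - 1) * bernoulli (p - 3) ∈
      padicBall p r := by
  induction r, hr using Nat.le_induction with
  | base =>
    have h := mul_mem_padicBall_right (intCast_mem_padicBall_zero (-2))
      (sum_primeToInv_sq_mul_sum_sub_bernoulli_mem hp2)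
    rw [pow_one, Nat.sub_self, pow_zero]
    convert add_mem primeToTripleSum_self_sub_mem h using 1
    push_cast
    ring
  | succ r hr ih =>
    have h := mul_mem_padicBall ih (natCast_mem_padicBall_one (p := p))
    convert add_mem (primeToTripleSum_pow_succ_sub_mem hp2 hr) h using 1
    obtain ⟨r, rfl⟩ := Nat.exists_eq_add_of_le' hr
    simp only [Nat.add_sub_cancel]
    ring

end primeToTripleSum

theorem Z_p_pow_congr (p r : ℕ) (hp : p.Prime) (hp2 : p ≠ 2) (hr : 1 ≤ r) :
    ratCong (p ^ r) (Z (p ^ r)) (-2 * (p : ℚ) ^ (r - 1) * bernoulli (p - 3)) := by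
  have : Fact p.Prime := ⟨hp⟩
  rw [Z_eq_primeToTripleSum hp hr]
  exact ratCong_of_sub_mem_padicBall (primeToTripleSum_pow_sub_bernoulli_mem hp2 hr)
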